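/- arXiv:1405.5818 — 2 statements merged into one kernel-verified Lean document; each statement's English description precedes it below -/
import Mathlib

section
/- Let C be a finite abelian ℓ-group and A a finite abelian ℓ-group such that C has exactly one subgroup isomorphic to A, say A₀ ≤ C. If there does not exist an injective group homomorphism ι : A → C whose cokernel is elementary abelian (i.e., every nonzero element of coker(ι) has order ℓ), then μ_C(A₀, C) = 0. -/
/-- Weisner's theorem for a finite lattice: if `f` sums to zero over every interval `[a, k]` with
`a < k`, then for `a < b` it sums to zero over the elements above `a` whose join with `b` is `k`. -/
theorem sum_filter_sup_eq_zero {α : Type*} [Lattice α] [Fintype α] [DecidableEq α] [DecidableLE α]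
    (f : α → ℤ) {a b : α} (hab : a < b)
    (hf : ∀ k, a < k → ∑ x with a ≤ x ∧ x ≤ k, f x = 0) (k : α) :
    ∑ x with a ≤ x ∧ x ⊔ b = k, f x = 0 := by
  induction k using WellFoundedLT.induction with
  | ind k ih =>
    by_cases hbk : b ≤ k
    · have hfib : ∑ j with j ≤ k, ∑ x with a ≤ x ∧ x ⊔ b = j, f x
          = ∑ x with a ≤ x ∧ x ≤ k, f x := by
        rw [← Finset.sum_fiberwise_of_maps_to (s := Finset.univ.filter fun x => a ≤ x ∧ x ≤ k)
          (t := Finset.univ.filter fun j => j ≤ k) (g := fun x => x ⊔ b)]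
        · refine Finset.sum_congr rfl fun j hj => Finset.sum_congr ?_ fun _ _ => rfl
          ext x
          simp only [Finset.mem_filter, Finset.mem_univ, true_and] at hj ⊢
          constructor
          · rintro ⟨hax, rfl⟩
            exact ⟨⟨hax, le_sup_left.trans hj⟩, rfl⟩
          · rintro ⟨⟨hax, -⟩, hj'⟩
            exact ⟨hax, hj'⟩
        · intro x hx
          simp only [Finset.mem_filter, Finset.mem_univ, true_and] at hx ⊢
          exact sup_le hx.2 hbk
      rw [hf k (hab.trans_le hbk), Finset.sum_eq_single k] at hfib
      · exact hfib
      · intro j hj hjk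
        exact ih j (lt_of_le_of_ne (by simpa using hj) hjk)
      · simp
    · refine Finset.sum_eq_zero fun x hx => absurd ?_ hbk
      simp only [Finset.mem_filter, Finset.mem_univ, true_and] at hx
      exact hx.2 ▸ le_sup_right

/-- In a finite abelian `p`-group `C`, the elements of `pC` are non-generators. -/
theorem AddSubgroup.eq_top_of_sup_range_nsmul_eq_top {C : Type*} [AddCommGroup C] [Finite C]
    {p : ℕ} (hC : ∀ x : C, ∃ n : ℕ, p ^ n • x = 0) {L : AddSubgroup C}
    (hL : L ⊔ (nsmulAddMonoidHom (α := C) p).range = ⊤) : L = ⊤ := by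
  have hsurj : Function.Surjective fun q : C ⧸ L => p • q := by
    intro q
    obtain ⟨x, rfl⟩ := QuotientAddGroup.mk_surjective q
    have hx : x ∈ L ⊔ (nsmulAddMonoidHom (α := C) p).range := hL ▸ AddSubgroup.mem_top x
    obtain ⟨l, hl, _, ⟨y, rfl⟩, rfl⟩ := AddSubgroup.mem_sup.1 hx
    refine ⟨(y : C ⧸ L), ?_⟩
    simp [(QuotientAddGroup.eq_zero_iff l).2 hl]
  have hinj := Finite.injective_iff_surjective.2 hsurj
  have hzero : ∀ (n : ℕ) (q : C ⧸ L), p ^ n • q = 0 → q = 0 := by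
    intro n
    induction n with
    | zero => simp
    | succ n ih =>
      intro q hq
      exact ih q (hinj (by simpa [pow_succ', mul_smul] using hq))
  refine (AddSubgroup.eq_top_iff' L).2 fun x => ?_
  obtain ⟨n, hn⟩ := hC x
  rw [← QuotientAddGroup.eq_zero_iff]
  exact hzero n x (by rw [← QuotientAddGroup.mk_nsmul, hn, QuotientAddGroup.mk_zero])


/-- Let `C` be a finite abelian `ℓ`-group having exactly one subgroup
`A₀` isomorphic to the finite abelian `ℓ`-group `A`.  Here `μ` is the Möbius function of
the poset of subgroups of `C` (characterized by its defining properties).  If there is no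
injection `ι : A ↪ C` with elementary abelian cokernel, then `μ(A₀, C) = 0`. -/
theorem statement4 (ℓ : ℕ) (hp : ℓ.Prime) (hodd : Odd ℓ)
    (C : Type) [AddCommGroup C] [Finite C] (hC : ∀ x : C, ∃ n : ℕ, ℓ ^ n • x = 0)
    (A : Type) [AddCommGroup A] [Finite A] (hA : ∀ x : A, ∃ n : ℕ, ℓ ^ n • x = 0)
    (μ : AddSubgroup C → AddSubgroup C → ℤ)
    (hμ0 : ∀ H K : AddSubgroup C, ¬ H ≤ K → μ H K = 0)
    (hμ1 : ∀ H : AddSubgroup C, μ H H = 1)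
    (hμ2 : ∀ H K : AddSubgroup C, H < K →
      (∑ᶠ L ∈ {L : AddSubgroup C | H ≤ L ∧ L ≤ K}, μ H L) = 0)
    (A₀ : AddSubgroup C) (hA₀ : Nonempty (A₀ ≃+ A))
    (huniq : ∀ B : AddSubgroup C, Nonempty (B ≃+ A) → B = A₀)
    (hco : ¬ ∃ ι : A →+ C, Function.Injective ι ∧
      ∀ x : C ⧸ ι.range, x ≠ 0 → addOrderOf x = ℓ) :
    μ A₀ ⊤ = 0 := by
  classical
  have := Fintype.ofFinite (AddSubgroup C)
  set P := (nsmulAddMonoidHom (α := C) ℓ).range with hP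
  have hPA : ¬ P ≤ A₀ := by
    intro hle
    obtain ⟨e⟩ := hA₀
    have hrange : (A₀.subtype.comp e.symm.toAddMonoidHom).range = A₀ := by
      ext x
      constructor
      · rintro ⟨a, rfl⟩
        exact (e.symm a).2
      · intro hx
        exact ⟨e ⟨x, hx⟩, by simp⟩
    refine hco ⟨A₀.subtype.comp e.symm.toAddMonoidHom,
      A₀.subtype_injective.comp e.symm.injective, fun q hq => ?_⟩
    have := Fact.mk hp
    refine addOrderOf_eq_prime ?_ hq
    obtain ⟨x, rfl⟩ := QuotientAddGroup.mk_surjective q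
    rw [← QuotientAddGroup.mk_nsmul, QuotientAddGroup.eq_zero_iff, hrange]
    exact hle ⟨x, rfl⟩
  have hsum := sum_filter_sup_eq_zero (μ A₀) (a := A₀) (b := A₀ ⊔ P)
    (left_lt_sup.2 hPA) (fun K hK => by
      rw [← hμ2 A₀ K hK, finsum_mem_eq_finite_toFinset_sum _ (Set.toFinite _)]
      exact Finset.sum_congr (by ext; simp) fun _ _ => rfl) ⊤
  rwa [show (Finset.univ.filter fun L => A₀ ≤ L ∧ L ⊔ (A₀ ⊔ P) = ⊤) = {⊤} from ?_,
    Finset.sum_singleton] at hsum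
  ext L
  simp only [Finset.mem_filter, Finset.mem_univ, true_and, Finset.mem_singleton]
  constructor
  · rintro ⟨hAL, hL⟩
    rw [← sup_assoc, sup_eq_left.2 hAL] at hL
    exact AddSubgroup.eq_top_of_sup_range_nsmul_eq_top hC hL
  · rintro rfl
    simp
end

section
/- Let A = ⊕_{i=1}^r ℤ/ℓ^{a_i} and B = ⊕_{i=1}^{r'} ℤ/ℓ^{b_i} with a_i ≥ a_j and b_i ≥ b_j whenever i ≤ j, and with all a_i, b_i ≥ 1. Then the number of injective group homomorphisms from A into B equals |Λ(A)| · ∏_{i=1}^r ( ℓ^{Σ_{j=i}^{r'} min(a_i, b_j)} − ℓ^{Σ_{j=i}^{r'} min(a_i − 1, b_j)} ), where Λ(A) denotes the set of alternating bilinear forms on A regarded as a module over ℤ/exp(A)ℤ. -/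
/-- `Λ(A)`: alternating `ℤ/exp(A)ℤ`-bilinear forms on `A`.  (For `ℤ/n`-modules,
a map additive in each variable is automatically `ℤ/n`-bilinear, so bilinearity is
recorded as biadditivity.) -/
def AltForms (A : Type) [AddCommGroup A] : Type :=
  {f : A → A → ZMod (AddMonoid.exponent A) //
    (∀ x y z, f (x + y) z = f x z + f y z) ∧
    (∀ x y z, f x (y + z) = f x y + f x z) ∧
    (∀ x, f x x = 0)}

/-- The subgroup of elements killed by `n`. -/
abbrev nsmulKer (B : Type*) [AddCommGroup B] (n : ℕ) : AddSubgroup B :=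
  (nsmulAddMonoidHom n : B →+ B).ker

section Torsion

variable {B : Type*} [AddCommGroup B]

theorem mem_nsmulKer {n : ℕ} {x : B} : x ∈ nsmulKer B n ↔ n • x = 0 := Iff.rfl

theorem nsmul_coe_nsmulKer {n : ℕ} (x : nsmulKer B n) : n • (x : B) = 0 := x.2

theorem card_nsmulKer_zmod (m n : ℕ) [NeZero m] : Nat.card (nsmulKer (ZMod m) n) = m.gcd n := by
  simpa using IsAddCyclic.card_nsmulAddMonoidHom_ker (ZMod m) n

/-- The `n`-torsion of a product is the product of the `n`-torsions. -/
def nsmulKerPiEquiv {ι : Type*} (G : ι → Type*) [∀ i, AddCommGroup (G i)] (n : ℕ) :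
    nsmulKer (∀ i, G i) n ≃ ∀ i, nsmulKer (G i) n where
  toFun x i := ⟨x.1 i, congrFun x.2 i⟩
  invFun x := ⟨fun i => x i, funext fun i => (x i).2⟩
  left_inv _ := rfl
  right_inv _ := rfl

/-- The homomorphism `ZMod n →+ B` sending `1` to a given element killed by `n`. -/
def zmodHomOfTorsion {n : ℕ} (x : nsmulKer B n) : ZMod n →+ B :=
  ZMod.lift n ⟨zmultiplesHom B x.1, by simpa using nsmul_coe_nsmulKer x⟩

theorem zmodHomOfTorsion_intCast {n : ℕ} (x : nsmulKer B n) (k : ℤ) :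
    zmodHomOfTorsion x (k : ZMod n) = k • (x : B) := by
  simp [zmodHomOfTorsion]

theorem zmodHomOfTorsion_one {n : ℕ} (x : nsmulKer B n) :
    zmodHomOfTorsion x 1 = (x : B) := by
  simpa using zmodHomOfTorsion_intCast x 1

theorem zmodHom_ext {n : ℕ} {f g : ZMod n →+ B} (h : f 1 = g 1) : f = g := by
  ext x
  obtain ⟨k, rfl⟩ := ZMod.intCast_surjective x
  rw [← zsmul_one, map_zsmul, map_zsmul, h]

/-- A homomorphism out of a finite product of cyclic groups is determined by the images of the
standard generators, which are arbitrary subject to the torsion conditions. -/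
def piZModHomEquiv {ι : Type*} [Fintype ι] [DecidableEq ι] (n : ι → ℕ) :
    ((∀ i, ZMod (n i)) →+ B) ≃ ∀ i, nsmulKer B (n i) where
  toFun f i := ⟨f (Pi.single i 1), by
    rw [mem_nsmulKer, ← map_nsmul, ← Pi.single_smul, nsmul_one, ZMod.natCast_self,
      Pi.single_zero, map_zero]⟩
  invFun x := ∑ i, (zmodHomOfTorsion (x i)).comp (Pi.evalAddMonoidHom _ i)
  left_inv f := by
    refine AddMonoidHom.functions_ext' _ _ _ fun i => zmodHom_ext ?_
    simp only [AddMonoidHom.comp_apply, AddMonoidHom.finsetSum_apply, Pi.evalAddMonoidHom_apply,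
      AddMonoidHom.single_apply]
    rw [Finset.sum_eq_single i]
    · simp [zmodHomOfTorsion_one]
    · intro j _ hj
      rw [Pi.single_eq_of_ne hj, map_zero]
    · simp
  right_inv x := by
    funext i
    apply Subtype.ext
    simp only [AddMonoidHom.comp_apply, AddMonoidHom.finsetSum_apply, Pi.evalAddMonoidHom_apply]
    rw [Finset.sum_eq_single i]
    · simp [zmodHomOfTorsion_one]
    · intro j _ hj
      rw [Pi.single_eq_of_ne hj, map_zero]
    · simp

theorem piZModHomEquiv_apply_coe {ι : Type*} [Fintype ι] [DecidableEq ι] (n : ι → ℕ)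
    (f : (∀ i, ZMod (n i)) →+ B) (i : ι) : (piZModHomEquiv n f i : B) = f (Pi.single i 1) := rfl

theorem card_zmodHom (n : ℕ) : Nat.card (ZMod n →+ B) = Nat.card (nsmulKer B n) :=
  Nat.card_congr
    { toFun f := ⟨f 1, by rw [mem_nsmulKer, ← map_nsmul, nsmul_one, ZMod.natCast_self, map_zero]⟩
      invFun := zmodHomOfTorsion
      left_inv f := zmodHom_ext (zmodHomOfTorsion_one _)
      right_inv x := Subtype.ext (zmodHomOfTorsion_one x) }

end Torsion

section Alternating

/-- Biadditive alternating maps from `A` to `M`. -/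
def AltMaps (A M : Type*) [AddCommGroup A] [AddCommGroup M] : Type _ :=
  {f : A → A → M //
    (∀ x y z, f (x + y) z = f x z + f y z) ∧
    (∀ x y z, f x (y + z) = f x y + f x z) ∧
    (∀ x, f x x = 0)}

variable {A A' M : Type*} [AddCommGroup A] [AddCommGroup A'] [AddCommGroup M]

namespace AltMaps

theorem add_left (f : AltMaps A M) (x y z : A) : f.1 (x + y) z = f.1 x z + f.1 y z := f.2.1 x y z

theorem add_right (f : AltMaps A M) (x y z : A) : f.1 x (y + z) = f.1 x y + f.1 x z := f.2.2.1 x y z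

theorem self (f : AltMaps A M) (x : A) : f.1 x x = 0 := f.2.2.2 x

theorem swap (f : AltMaps A M) (x y : A) : f.1 x y = - f.1 y x := by
  have h := f.self (x + y)
  rw [f.add_left, f.add_right, f.add_right, f.self, f.self, zero_add, add_zero] at h
  exact eq_neg_of_add_eq_zero_left h

/-- An alternating map as a homomorphism to the group of homomorphisms. -/
def toHom (f : AltMaps A M) : A →+ A →+ M :=
  AddMonoidHom.mk' (fun x => AddMonoidHom.mk' (f.1 x) (f.add_right x))
    fun x y => AddMonoidHom.ext fun z => f.add_left x y z

theorem toHom_apply (f : AltMaps A M) (x y : A) : f.toHom x y = f.1 x y := rfl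

/-- Transport of alternating maps along an isomorphism. -/
def congr (e : A ≃+ A') : AltMaps A M ≃ AltMaps A' M where
  toFun f := ⟨fun x y => f.1 (e.symm x) (e.symm y), by simp [f.add_left], by simp [f.add_right],
    fun x => f.self _⟩
  invFun f := ⟨fun x y => f.1 (e x) (e y), by simp [f.add_left], by simp [f.add_right],
    fun x => f.self _⟩
  left_inv f := by apply Subtype.ext; simp
  right_inv f := by apply Subtype.ext; simp

theorem apply_zmod (n : ℕ) (f : AltMaps (ZMod n) M) (s t : ZMod n) : f.1 s t = 0 := by
  obtain ⟨s, rfl⟩ := ZMod.intCast_surjective s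
  obtain ⟨t, rfl⟩ := ZMod.intCast_surjective t
  rw [← f.toHom_apply, ← zsmul_one (s : ℤ), ← zsmul_one (t : ℤ), map_zsmul, map_zsmul,
    AddMonoidHom.smul_apply, f.toHom_apply, f.self, smul_zero, smul_zero]

/-- Pullback of an alternating map. -/
def comap (g : A' →+ A) (f : AltMaps A M) : AltMaps A' M :=
  ⟨fun x y => f.1 (g x) (g y), by simp [f.add_left], by simp [f.add_right], fun _ => f.self _⟩

/-- An alternating map on `A × ZMod n` consists of an alternating map on `A` and a pairing
of `A` with `ZMod n`. -/
def prodZModEquiv (n : ℕ) : AltMaps (A × ZMod n) M ≃ AltMaps A M × (A →+ ZMod n →+ M) where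
  toFun f := (f.comap (AddMonoidHom.inl _ _),
    AddMonoidHom.mk' (fun x => (f.toHom (x, 0)).comp (AddMonoidHom.inr _ _)) fun x y => by
      ext; simp [toHom_apply, ← f.add_left])
  invFun p := ⟨fun x y => p.1.1 x.1 y.1 + (p.2 x.1 y.2 - p.2 y.1 x.2),
    fun x y z => by simp [p.1.add_left]; abel,
    fun x y z => by simp [p.1.add_right]; abel,
    fun x => by simp [p.1.self]⟩
  left_inv f := by
    apply Subtype.ext
    funext ⟨x, s⟩ ⟨y, t⟩
    have h : f.1 (0, s) (0, t) = 0 := apply_zmod n (f.comap (AddMonoidHom.inr A (ZMod n))) s t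
    have hx : ((x, s) : A × ZMod n) = (x, 0) + (0, s) := by simp
    have hy : ((y, t) : A × ZMod n) = (y, 0) + (0, t) := by simp
    rw [hx, hy, f.add_left, f.add_right, f.add_right, h, f.swap (0, s)]
    simp [toHom_apply, comap]
    abel
  right_inv p := by
    refine Prod.ext (Subtype.ext ?_) ?_
    · funext x y
      simp [comap]
    · ext x s
      have h : p.1.1 x 0 = 0 := map_zero (p.1.toHom x)
      change p.1.1 x 0 + (p.2 x s - p.2 0 0) = p.2 x s
      simp [h]

end AltMaps

/-- Splitting off the last factor of a product indexed by `Fin (k + 1)`. -/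
def piFinSuccAddEquiv {k : ℕ} (G : Fin (k + 1) → Type*) [∀ i, AddCommGroup (G i)] :
    (∀ i, G i) ≃+ (∀ i : Fin k, G i.castSucc) × G (Fin.last k) where
  __ := ((Fin.snocEquiv G).symm.trans (Equiv.prodComm _ _))
  map_add' _ _ := rfl

theorem card_altMaps_pi_zmod (M : Type*) [AddCommGroup M] (n : ℕ → ℕ) (k : ℕ)
    (hn : ∀ i j, i ≤ j → j < k → n j ∣ n i) :
    Nat.card (AltMaps (∀ i : Fin k, ZMod (n i)) M)
      = ∏ j ∈ Finset.range k, Nat.card (nsmulKer M (n j)) ^ j := by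
  induction k with
  | zero =>
    rw [Finset.range_zero, Finset.prod_empty, Nat.card_eq_one_iff_unique]
    refine ⟨⟨fun f g => Subtype.ext ?_⟩, ⟨⟨fun _ _ => 0, by simp, by simp, by simp⟩⟩⟩
    funext x y
    rw [Subsingleton.elim x y, f.self, g.self]
  | succ k ih =>
    rw [Nat.card_congr ((AltMaps.congr (piFinSuccAddEquiv
      fun i : Fin (k + 1) => ZMod (n i))).trans (AltMaps.prodZModEquiv _)), Nat.card_prod,
      Finset.prod_range_succ, Nat.card_congr (piZModHomEquiv _), Nat.card_pi]
    refine congrArg₂ _ (ih fun i j h hj => hn i j h (by omega)) ?_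
    rw [Finset.prod_congr rfl (g := fun _ => Nat.card (nsmulKer M (n k))), Finset.prod_const,
      Finset.card_univ, Fintype.card_fin]
    intro i _
    rw [← card_zmodHom (B := M)]
    refine Nat.card_congr (Equiv.subtypeUnivEquiv fun f => ?_)
    obtain ⟨d, hd⟩ := hn i k (by omega) (by omega)
    rw [mem_nsmulKer]
    refine zmodHom_ext ?_
    rw [AddMonoidHom.smul_apply, ← map_nsmul, nsmul_one]
    simp [hd]

end Alternating

section Counting

theorem card_sigma_of_forall_card_eq {α : Type*} {β : α → Type*} [Finite α] [∀ x, Finite (β x)]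
    {n : ℕ} (h : ∀ x, Nat.card (β x) = n) : Nat.card (Σ x, β x) = Nat.card α * n := by
  have := Fintype.ofFinite α
  simp [Nat.card_sigma, h]

/-- The number of elements whose image avoids a subgroup of the range of a homomorphism. -/
theorem card_apply_notMem {G H : Type*} [AddCommGroup G] [AddCommGroup H] [Finite G] [Finite H]
    (φ : G →+ H) (W : AddSubgroup H) (hW : W ≤ φ.range) :
    Nat.card {g // φ g ∉ W} = Nat.card G - Nat.card W * Nat.card φ.ker := by
  have hcard : Nat.card (W.comap φ) = Nat.card W * Nat.card φ.ker := by
    have h1 := (W.comap φ).card_mul_index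
    rw [AddSubgroup.index_comap, ← φ.ker.card_mul_index, AddSubgroup.index_ker,
      ← AddSubgroup.relIndex_bot_left φ.range, ← AddSubgroup.relIndex_mul_relIndex ⊥ W _ bot_le hW,
      AddSubgroup.relIndex_bot_left] at h1
    have h2 : W.relIndex φ.range ≠ 0 := AddSubgroup.index_ne_zero_of_finite
    apply Nat.eq_of_mul_eq_mul_right (Nat.pos_of_ne_zero h2)
    rw [h1]; ring
  rw [← hcard]
  have := Fintype.ofFinite G
  classical
  rw [Nat.card_eq_fintype_card, Nat.card_eq_fintype_card, Nat.card_eq_fintype_card,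
    ← Fintype.card_subtype_compl]
  rfl

/-- A linearly independent family `φ i (x i)` indexed by `Fin (k + 1)` is built by extending a
linearly independent family indexed by `Fin k` by a vector outside its span. -/
def linearIndependentSnocEquiv {K V : Type*} [DivisionRing K] [AddCommGroup V] [Module K V] {k : ℕ}
    {G : Fin (k + 1) → Type*} (φ : ∀ i, G i → V) :
    {x : ∀ i, G i // LinearIndependent K fun i => φ i (x i)} ≃
      Σ x : {x : ∀ i : Fin k, G i.castSucc // LinearIndependent K fun i => φ i.castSucc (x i)},
        {y : G (Fin.last k) //
          φ _ y ∉ Submodule.span K (Set.range fun i => φ i.castSucc (x.1 i))} :=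
  have h (x : ∀ i, G i) : LinearIndependent K (fun i => φ i (x i)) ↔
      LinearIndependent K (fun i : Fin k => φ i.castSucc (x i.castSucc)) ∧
        φ _ (x (Fin.last k)) ∉
          Submodule.span K (Set.range fun i : Fin k => φ i.castSucc (x i.castSucc)) := by
    rw [← linearIndependent_finSnoc]
    have hx : (fun i => φ i (x i)) = Fin.snoc (fun i : Fin k => φ i.castSucc (x i.castSucc))
        (φ _ (x (Fin.last k))) :=
      funext fun i => by induction i using Fin.lastCases <;> simp
    rw [hx]
  { toFun x := ⟨⟨fun i => x.1 i.castSucc, ((h x.1).1 x.2).1⟩, x.1 (Fin.last k), ((h x.1).1 x.2).2⟩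
    invFun z := ⟨Fin.snoc z.1.1 z.2.1, (h _).2 (by simpa using ⟨z.1.2, z.2.2⟩)⟩
    left_inv x := Subtype.ext (Fin.snoc_init_self x.1)
    right_inv z := Sigma.subtype_ext (Subtype.ext (by simp)) (by simp) }

variable {B : Type*} [AddCommGroup B] {p : ℕ}

/-- The `p`-torsion subgroup is a vector space over `ZMod p`. -/
abbrev nsmulKerModule (B : Type*) [AddCommGroup B] (p : ℕ) : Module (ZMod p) (nsmulKer B p) :=
  AddCommGroup.zmodModule fun x => Subtype.ext x.2

attribute [local instance] nsmulKerModule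

/-- Multiplication by `p ^ (n - 1)`, from the `p ^ n`-torsion to the `p`-torsion. -/
def toSocle (B : Type*) [AddCommGroup B] (p n : ℕ) : nsmulKer B (p ^ n) →+ nsmulKer B p :=
  ((nsmulAddMonoidHom (p ^ (n - 1))).comp (nsmulKer B (p ^ n)).subtype).codRestrict _ fun x => by
    have hx := nsmul_coe_nsmulKer x
    rcases n with _ | n
    · have h : (x : B) = 0 := by simpa using hx
      change p • p ^ 0 • (x : B) = 0
      rw [h, nsmul_zero, nsmul_zero]
    · simpa [mem_nsmulKer, ← mul_nsmul, ← pow_succ] using hx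

theorem coe_toSocle {n : ℕ} (x : nsmulKer B (p ^ n)) :
    (toSocle B p n x : B) = p ^ (n - 1) • (x : B) := rfl

theorem card_ker_toSocle (n : ℕ) :
    Nat.card (toSocle B p n).ker = Nat.card (nsmulKer B (p ^ (n - 1))) :=
  Nat.card_congr
    { toFun x := ⟨x.1.1, congrArg Subtype.val x.2⟩
      invFun x := ⟨⟨x.1, by
        obtain ⟨d, hd⟩ := pow_dvd_pow p (Nat.sub_le n 1)
        rw [mem_nsmulKer, hd, mul_nsmul, nsmul_coe_nsmulKer, nsmul_zero]⟩, Subtype.ext x.2⟩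
      left_inv _ := rfl
      right_inv _ := rfl }

theorem range_toSocle_anti {m n : ℕ} (hm : 1 ≤ m) (hmn : m ≤ n) :
    (toSocle B p n).range ≤ (toSocle B p m).range := by
  rintro _ ⟨x, rfl⟩
  refine ⟨⟨p ^ (n - m) • (x : B), ?_⟩, Subtype.ext ?_⟩
  · rw [mem_nsmulKer, ← mul_nsmul, ← pow_add, Nat.sub_add_cancel hmn, nsmul_coe_nsmulKer]
  · rw [coe_toSocle, coe_toSocle, ← mul_nsmul, ← pow_add]
    congr 2
    omega

theorem card_linearIndependent_toSocle [Finite B] [Fact p.Prime] (a : ℕ → ℕ) (k : ℕ)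
    (ha : ∀ i j, i ≤ j → j < k → a j ≤ a i) (ha1 : ∀ i < k, 1 ≤ a i) :
    Nat.card {x : ∀ i : Fin k, nsmulKer B (p ^ a i) //
        LinearIndependent (ZMod p) fun i : Fin k => toSocle B p (a i) (x i)}
      = ∏ i ∈ Finset.range k,
          (Nat.card (nsmulKer B (p ^ a i)) - p ^ i * Nat.card (nsmulKer B (p ^ (a i - 1)))) := by
  induction k with
  | zero =>
    rw [Finset.range_zero, Finset.prod_empty, Nat.card_eq_one_iff_unique]
    exact ⟨inferInstance, ⟨⟨fun i => i.elim0, linearIndependent_empty_type⟩⟩⟩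
  | succ k ih =>
    rw [Finset.prod_range_succ, ← ih (fun i j h hj => ha i j h (by omega)) fun i hi =>
      ha1 i (by omega)]
    rw [Nat.card_congr (linearIndependentSnocEquiv (K := ZMod p)
      (G := fun i : Fin (k + 1) => nsmulKer B (p ^ a i)) fun i => toSocle B p (a i))]
    refine card_sigma_of_forall_card_eq ?_
    rintro ⟨x, hx⟩
    let W : Submodule (ZMod p) (nsmulKer B p) :=
      Submodule.span (ZMod p) (Set.range fun i : Fin k => toSocle B p (a i) (x i))
    refine (card_apply_notMem (toSocle B p (a k)) W.toAddSubgroup ?_).trans ?_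
    swap
    · have hW : Module.finrank (ZMod p) W = k :=
        (finrank_span_eq_card hx).trans (Fintype.card_fin k)
      have hcard : Nat.card W.toAddSubgroup = p ^ k := by
        change Nat.card W = _
        rw [Module.natCard_eq_pow_finrank (K := ZMod p), Nat.card_zmod, hW]
      rw [card_ker_toSocle, hcard]
    · change W ≤ AddSubgroup.toZModSubmodule p (toSocle B p (a k)).range
      rw [Submodule.span_le]
      rintro _ ⟨i, rfl⟩
      exact range_toSocle_anti (ha1 k (by omega)) (ha i k (by omega) (by omega)) ⟨x i, rfl⟩

/-- A homomorphism out of a product of cyclic `p`-groups is injective if and only if the socles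
of the images of the generators are linearly independent. -/
theorem injective_iff_linearIndependent_toSocle [Fact p.Prime] {ι : Type*} [Fintype ι]
    [DecidableEq ι] (a : ι → ℕ) (ha : ∀ i, 1 ≤ a i) (f : (∀ i, ZMod (p ^ a i)) →+ B) :
    Function.Injective f ↔ LinearIndependent (ZMod p) fun i =>
      toSocle B p (a i) (piZModHomEquiv (fun i => p ^ a i) f i) := by
  have hp : p.Prime := Fact.out
  have key (t : ι → ℕ) :
      ((∑ i, (t i : ZMod p) • toSocle B p (a i) (piZModHomEquiv (fun i => p ^ a i) f i) :
        nsmulKer B p) : B) = f fun i => ((p ^ (a i - 1) * t i : ℕ) : ZMod (p ^ a i)) := by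
    rw [← Finset.univ_sum_single fun i => ((p ^ (a i - 1) * t i : ℕ) : ZMod (p ^ a i)), map_sum,
      AddSubmonoidClass.coe_finsetSum]
    refine Finset.sum_congr rfl fun i _ => ?_
    rw [Nat.cast_smul_eq_nsmul, AddSubgroup.coe_nsmul, coe_toSocle, piZModHomEquiv_apply_coe,
      ← mul_nsmul, ← map_nsmul, ← Pi.single_smul, nsmul_one]
  have hdvd (i : ι) (t : ℕ) : ((p ^ (a i - 1) * t : ℕ) : ZMod (p ^ a i)) = 0 ↔ p ∣ t := by
    rw [ZMod.natCast_eq_zero_iff]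
    nth_rw 1 [← Nat.sub_add_cancel (ha i)]
    rw [pow_succ, Nat.mul_dvd_mul_iff_left (pow_pos hp.pos _)]
  rw [Fintype.linearIndependent_iff]
  constructor
  · intro hf g hg i
    have h := key fun i => (g i).val
    simp only [ZMod.natCast_val, ZMod.cast_id', id_eq] at h
    rw [hg, ZeroMemClass.coe_zero, eq_comm, map_eq_zero_iff f hf] at h
    rw [← ZMod.natCast_zmod_val (g i), ZMod.natCast_eq_zero_iff, ← hdvd i]
    exact congrFun h i
  · intro hli
    have hsocle (v : ∀ i, ZMod (p ^ a i)) (hv : p • v = 0) (hfv : f v = 0) : v = 0 := by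
      have ht (i : ι) : ∃ t : ℕ, v i = ((p ^ (a i - 1) * t : ℕ) : ZMod (p ^ a i)) := by
        have h : p • v i = 0 := congrFun hv i
        have : NeZero (p ^ a i) := ⟨(pow_pos hp.pos _).ne'⟩
        rw [← ZMod.natCast_zmod_val (v i), nsmul_eq_mul, ← Nat.cast_mul,
          ZMod.natCast_eq_zero_iff] at h
        nth_rw 1 [← Nat.sub_add_cancel (ha i)] at h
        rw [pow_succ', Nat.mul_dvd_mul_iff_left hp.pos] at h
        obtain ⟨t, ht⟩ := h
        exact ⟨t, by rw [← ht, ZMod.natCast_zmod_val]⟩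
      choose t ht using ht
      have hv' : v = fun i => ((p ^ (a i - 1) * t i : ℕ) : ZMod (p ^ a i)) := funext ht
      have h := hli (fun i => (t i : ZMod p)) (Subtype.ext ((key t).trans (hv' ▸ hfv)))
      funext i
      rw [ht i, Pi.zero_apply, hdvd, ← ZMod.natCast_eq_zero_iff]
      exact h i
    rw [injective_iff_map_eq_zero]
    have hpow (n : ℕ) : ∀ u, p ^ n • u = 0 → f u = 0 → u = 0 := by
      induction n with
      | zero => intro u hu _; simpa using hu
      | succ n ih =>
        intro u hu hfu
        refine hsocle u (ih _ ?_ ?_) hfu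
        · rwa [← mul_nsmul, ← pow_succ']
        · rw [map_nsmul, hfu, nsmul_zero]
    refine fun u => hpow (∑ i, a i) u (funext fun i => ?_)
    have hle : a i ≤ ∑ i, a i := Finset.single_le_sum (fun _ _ => Nat.zero_le _) (Finset.mem_univ i)
    obtain ⟨d, hd⟩ := pow_dvd_pow p hle
    rw [Pi.smul_apply, hd, nsmul_eq_mul, Nat.cast_mul, ZMod.natCast_self, zero_mul, zero_mul,
      Pi.zero_apply]

theorem card_injective_piZModHom [Finite B] [Fact p.Prime] (a : ℕ → ℕ) (k : ℕ)
    (ha : ∀ i j, i ≤ j → j < k → a j ≤ a i) (ha1 : ∀ i < k, 1 ≤ a i) :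
    Nat.card {f : (∀ i : Fin k, ZMod (p ^ a i)) →+ B // Function.Injective f}
      = ∏ i ∈ Finset.range k,
          (Nat.card (nsmulKer B (p ^ a i)) - p ^ i * Nat.card (nsmulKer B (p ^ (a i - 1)))) := by
  rw [← card_linearIndependent_toSocle a k ha ha1]
  exact Nat.card_congr ((piZModHomEquiv fun i : Fin k => p ^ a i).subtypeEquiv fun f =>
    injective_iff_linearIndependent_toSocle (fun i : Fin k => a i) (fun i => ha1 i i.2) f)

theorem card_nsmulKer_pi_zmod (hp : p.Prime) (b : ℕ → ℕ) (k n : ℕ) :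
    Nat.card (nsmulKer (∀ i : Fin k, ZMod (p ^ b i)) (p ^ n))
      = p ^ ∑ j ∈ Finset.range k, min n (b j) := by
  have (i : ℕ) : NeZero (p ^ b i) := ⟨(pow_pos hp.pos _).ne'⟩
  rw [Nat.card_congr (nsmulKerPiEquiv _ _), Nat.card_pi, ← Finset.prod_pow_eq_pow_sum,
    ← Fin.prod_univ_eq_prod_range fun j => p ^ min n (b j)]
  refine Finset.prod_congr rfl fun i _ => ?_
  rw [card_nsmulKer_zmod]
  rcases le_total n (b i) with h | h
  · rw [min_eq_left h, Nat.gcd_eq_right (pow_dvd_pow p h)]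
  · rw [min_eq_right h, Nat.gcd_eq_left (pow_dvd_pow p h)]

end Counting

theorem prod_sub_eq_of_antitone (p r r' : ℕ) (a b : ℕ → ℕ)
    (ha : ∀ i j, i ≤ j → j < r → a j ≤ a i) (hb : ∀ i j, i ≤ j → j < r' → b j ≤ b i)
    (ha1 : ∀ i, i < r → 1 ≤ a i) :
    ∏ i ∈ Finset.range r, (p ^ (∑ j ∈ Finset.range r', min (a i) (b j))
        - p ^ i * p ^ (∑ j ∈ Finset.range r', min (a i - 1) (b j)))
      = ∏ i ∈ Finset.range r, (p ^ a i) ^ i * (p ^ (∑ j ∈ Finset.Ico i r', min (a i) (b j))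
              - p ^ (∑ j ∈ Finset.Ico i r', min (a i - 1) (b j))) := by
  induction r with
  | zero => simp
  | succ r ih =>
    rw [Finset.prod_range_succ, Finset.prod_range_succ,
      ih (fun i j h hj => ha i j h (by omega)) fun i hi => ha1 i (by omega)]
    by_cases h : ∀ i < r, i < r' ∧ a r ≤ b i
    · congr 1
      have hr : r ≤ r' := by
        rcases r with _ | r
        · omega
        · exact (h r (by omega)).1
      have hsum (n : ℕ) (hn : n ≤ a r) : ∑ j ∈ Finset.range r', min n (b j) =
          r * n + ∑ j ∈ Finset.Ico r r', min n (b j) := by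
        rw [← Finset.sum_range_add_sum_Ico _ hr, Finset.sum_congr rfl (g := fun _ => n)]
        · simp
        · intro j hj
          exact min_eq_left (hn.trans (h j (Finset.mem_range.1 hj)).2)
      rw [hsum _ le_rfl, hsum _ (Nat.sub_le _ _), Nat.mul_sub ((p ^ a r) ^ r), ← pow_mul,
        ← pow_add, ← pow_add, ← pow_add, ← add_assoc, mul_comm (a r) r]
      congr 3
      have h1 := ha1 r (by omega)
      obtain ⟨c, hc⟩ := Nat.exists_eq_add_of_le' h1
      rw [hc]
      simp
      ring
    · push Not at h
      obtain ⟨i, hi, h⟩ := h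
      rw [Finset.prod_eq_zero (Finset.mem_range.2 hi), zero_mul, zero_mul]
      rw [Finset.sum_congr rfl (g := fun j => min (a i - 1) (b j)), Nat.sub_self, mul_zero]
      intro j hj
      rw [Finset.mem_Ico] at hj
      have h1 := h (by omega)
      have h2 := hb i j hj.1 hj.2
      have h3 := ha i r hi.le (by omega)
      omega

/-- With `A = ⊕_{i=1}^r ℤ/ℓ^{a_i}` and `B = ⊕_{i=1}^{r'} ℤ/ℓ^{b_i}`
(exponents weakly decreasing and positive), the number of injective homomorphisms `A ↪ B`
is `|Λ(A)| · ∏_{i=1}^r (ℓ^{Σ_{j=i}^{r'} min(a_i,b_j)} − ℓ^{Σ_{j=i}^{r'} min(a_i-1,b_j)})`. -/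
theorem statement6 (ℓ : ℕ) (hp : ℓ.Prime) (hodd : Odd ℓ) (r r' : ℕ) (a b : ℕ → ℕ)
    (ha : ∀ i j, i ≤ j → j < r → a j ≤ a i) (hb : ∀ i j, i ≤ j → j < r' → b j ≤ b i)
    (ha1 : ∀ i, i < r → 1 ≤ a i) (hb1 : ∀ i, i < r' → 1 ≤ b i) :
    Nat.card {f : (∀ i : Fin r, ZMod (ℓ ^ a i.val)) →+ (∀ i : Fin r', ZMod (ℓ ^ b i.val)) //
        Function.Injective f}
      = Nat.card (AltForms (∀ i : Fin r, ZMod (ℓ ^ a i.val)))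
        * ∏ i ∈ Finset.range r,
            (ℓ ^ (∑ j ∈ Finset.Ico i r', min (a i) (b j))
              - ℓ ^ (∑ j ∈ Finset.Ico i r', min (a i - 1) (b j))) := by
  have : Fact ℓ.Prime := ⟨hp⟩
  have (i : ℕ) (c : ℕ → ℕ) : NeZero (ℓ ^ c i) := ⟨(pow_pos hp.pos _).ne'⟩
  have hexp (j : ℕ) (hj : j < r) :
      ℓ ^ a j ∣ AddMonoid.exponent (∀ i : Fin r, ZMod (ℓ ^ a i.val)) := by
    rw [← ZMod.natCast_eq_zero_iff, ← nsmul_one]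
    exact congrFun ((AddMonoid.exponent_nsmul_eq_zero
      (1 : ∀ i : Fin r, ZMod (ℓ ^ a i.val)))) ⟨j, hj⟩
  have : NeZero (AddMonoid.exponent (∀ i : Fin r, ZMod (ℓ ^ a i.val))) :=
    ⟨AddMonoid.exponent_ne_zero_of_finite⟩
  have halt : Nat.card (AltForms (∀ i : Fin r, ZMod (ℓ ^ a i.val)))
      = ∏ j ∈ Finset.range r, (ℓ ^ a j) ^ j := by
    refine (card_altMaps_pi_zmod _ (fun i => ℓ ^ a i) r fun i j h hj =>
      pow_dvd_pow _ (ha i j h hj)).trans (Finset.prod_congr rfl fun j hj => ?_)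
    rw [card_nsmulKer_zmod, Nat.gcd_eq_right (hexp j (Finset.mem_range.1 hj))]
  rw [card_injective_piZModHom a r ha ha1, halt, ← Finset.prod_mul_distrib,
    ← prod_sub_eq_of_antitone ℓ r r' a b ha hb ha1]
  simp_rw [card_nsmulKer_pi_zmod hp]
end
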